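/- arXiv:cs/0311027 — 8 statements merged into one kernel-verified Lean document; each statement's English description precedes it below -/
import Mathlib

section
/- Let (A,S,C) be a decision situation, where S is a nonempty set of states, C a set of consequences, and A a nonempty set of simple acts a : S → C, and let ⪯_A be any reflexive binary relation on A. Then ⪯_A has a GEU representation: there exist an expectation domain E = (U,P,V,⊗,⊕), a utility function u : C → U, and a plausibility measure Pl : 2^S → P such that GEU(((A,S,C),E,u,Pl)) = ⪯_A, i.e., for all a1, a2 ∈ A, a1 ⪯_A a2 iff E_{Pl,E}(u_{a1}) ≤_V E_{Pl,E}(u_{a2}). -/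
open Classical

noncomputable section

universe u v w x y z

/-- An expectation domain `E = (U, P, V, ⊗, ⊕)`: a utility domain `(U, leU)` with a
reflexive relation, a plausibility domain `(P, leP)` (a partial order with `⊥` and `⊤`),
a valuation domain `(V, leV)` with a reflexive relation, `⊗ : P × U → V`, `⊕ : V × V → V`,
such that `⊕` is associative and commutative, `⊤ ⊗ u = u` (via the embedding `iota` of `U`
into `V`), and `(U, leU)` is a substructure of `(V, leV)`. -/
structure ExpectationDomain (U : Type w) (P : Type x) (V : Type y) where
  leU : U → U → Prop
  leU_refl : ∀ a, leU a a
  leP : P → P → Prop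
  leP_refl : ∀ p, leP p p
  leP_trans : ∀ p q r, leP p q → leP q r → leP p r
  leP_antisymm : ∀ p q, leP p q → leP q p → p = q
  bot : P
  top : P
  bot_le : ∀ p, leP bot p
  le_top : ∀ p, leP p top
  leV : V → V → Prop
  leV_refl : ∀ v, leV v v
  otimes : P → U → V
  oplus : V → V → V
  oplus_assoc : ∀ a b c, oplus (oplus a b) c = oplus a (oplus b c)
  oplus_comm : ∀ a b, oplus a b = oplus b a
  iota : U → V
  iota_injective : Function.Injective iota
  top_otimes : ∀ a, otimes top a = iota a
  leV_iota : ∀ a b, leV (iota a) (iota b) ↔ leU a b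

/-- `Pl : 2^S → P` is a plausibility measure: `Pl ∅ = ⊥`, `Pl S = ⊤`, and `Pl` is monotone. -/
def IsPlausMeasure {S : Type u} {U : Type w} {P : Type x} {V : Type y}
    (E : ExpectationDomain U P V) (Pl : Set S → P) : Prop :=
  Pl ∅ = E.bot ∧ Pl Set.univ = E.top ∧ ∀ X Y : Set S, X ⊆ Y → E.leP (Pl X) (Pl Y)

/-- A simple act: a function from states to consequences with finite range. -/
def SimpleAct (S : Type u) (C : Type v) : Type (max u v) :=
  {a : S → C // (Set.range a).Finite}

theorem SimpleAct.utility_range_finite {S : Type u} {C : Type v} {U : Type w}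
    (u : C → U) (a : SimpleAct S C) :
    (Set.range fun s => u (a.1 s)).Finite := by
  have h := a.2.image u
  have h2 : (Set.range fun s => u (a.1 s)) = u '' Set.range a.1 := by
    rw [← Set.range_comp]; rfl
  rw [h2]; exact h

/-- Generalized expected utility `⊕_{x ∈ ran f} Pl(f⁻¹(x)) ⊗ x` of a finite-range utility
random variable `f : S → U`, as a fold of the commutative associative operation `⊕` over the
(nonempty) finite range of `f`. -/
def ExpectationDomain.geu {S : Type u} {U : Type w} {P : Type x} {V : Type y}
    (E : ExpectationDomain U P V) (Pl : Set S → P) (f : S → U)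
    (hf : (Set.range f).Finite) (hS : Nonempty S) : V :=
  letI := Classical.decEq U
  letI : Std.Commutative E.oplus := ⟨E.oplus_comm⟩
  letI : Std.Associative E.oplus := ⟨E.oplus_assoc⟩
  let g : U → V := fun z => E.otimes (Pl (f ⁻¹' {z})) z
  have hne : hf.toFinset.Nonempty :=
    ⟨f (Classical.choice hS), hf.mem_toFinset.mpr (Set.mem_range_self _)⟩
  (hf.toFinset.erase hne.choose).fold E.oplus (g hne.choose) g

/-- The generalized expected utility of a simple act. -/
def geuVal {S : Type u} {C : Type v} {U : Type w} {P : Type x} {V : Type y}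
    [hS : Nonempty S] (E : ExpectationDomain U P V) (Pl : Set S → P)
    (u : C → U) (a : SimpleAct S C) : V :=
  E.geu Pl (fun s => u (a.1 s)) (SimpleAct.utility_range_finite u a) hS

/-- The GEU preference relation on acts. -/
def geuRel {S : Type u} {C : Type v} {U : Type w} {P : Type x} {V : Type y}
    [Nonempty S] (E : ExpectationDomain U P V) (Pl : Set S → P)
    (u : C → U) (a₁ a₂ : SimpleAct S C) : Prop :=
  E.leV (geuVal E Pl u a₁) (geuVal E Pl u a₂)

/-- Acts `a` and `b` are indistinguishable: they induce the same utility lottery, i.e.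
their utility random variables have the same range and assign the same plausibility to
each preimage of a value in the common range. -/
def Indist {S : Type u} {C : Type v} {U : Type w} {P : Type x}
    (Pl : Set S → P) (u : C → U) (a b : SimpleAct S C) : Prop :=
  Set.range (fun s => u (a.1 s)) = Set.range (fun s => u (b.1 s)) ∧
  ∀ z ∈ Set.range (fun s => u (a.1 s)),
    Pl ((fun s => u (a.1 s)) ⁻¹' {z}) = Pl ((fun s => u (b.1 s)) ⁻¹' {z})

theorem Finset.fold_union_eq {α β : Type*} (op : Set β → Set β → Set β)
    [Std.Commutative op] [Std.Associative op] (hop : ∀ x y, op x y = x ∪ y)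
    (b : Set β) (g : α → Set β) (s : Finset α) :
    s.fold op b g = b ∪ ⋃ x ∈ s, g x := by
  induction s using Finset.induction_on with
  | empty => simp
  | insert a s ha ih =>
    rw [Finset.fold_insert ha, ih, hop, Finset.set_biUnion_insert]
    exact Set.union_left_comm _ _ _

/-- When `⊕` is union of sets, generalized expected utility is the union of its terms. -/
theorem ExpectationDomain.geu_eq_iUnion {S : Type u} {U : Type w} {P : Type x} {β : Type y}
    (E : ExpectationDomain U P (Set β)) (hE : ∀ x y, E.oplus x y = x ∪ y) (Pl : Set S → P)
    (f : S → U) (hf : (Set.range f).Finite) (hS : Nonempty S) :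
    E.geu Pl f hf hS = ⋃ s, E.otimes (Pl (f ⁻¹' {f s})) (f s) := by
  have hne : hf.toFinset.Nonempty :=
    ⟨f (Classical.choice hS), hf.mem_toFinset.mpr (Set.mem_range_self _)⟩
  have : Std.Commutative E.oplus := ⟨E.oplus_comm⟩
  have : Std.Associative E.oplus := ⟨E.oplus_assoc⟩
  refine (Finset.fold_union_eq E.oplus hE _ _ _).trans ?_
  rw [← Finset.set_biUnion_insert _ _ fun z => E.otimes (Pl (f ⁻¹' {z})) z,
    Finset.insert_erase hne.choose_spec]
  simp only [Set.Finite.mem_toFinset, Set.biUnion_range]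

/-- The lottery of an act: each consequence it can have, paired with the event in which the
act has that consequence. -/
def SimpleAct.lottery {S : Type u} {C : Type v} (a : SimpleAct S C) : Set (Set S × C) :=
  ⋃ s, {(a.1 ⁻¹' {a.1 s}, a.1 s)}

theorem SimpleAct.lottery_injective {S : Type u} {C : Type v} :
    Function.Injective (SimpleAct.lottery : SimpleAct S C → Set (Set S × C)) := by
  intro a b h
  refine Subtype.ext (funext fun s => ?_)
  have hs : (a.1 ⁻¹' {a.1 s}, a.1 s) ∈ b.lottery := h ▸ Set.mem_iUnion.mpr ⟨s, rfl⟩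
  obtain ⟨t, ht⟩ := Set.mem_iUnion.mp hs
  obtain ⟨h₁, h₂⟩ := Prod.mk.inj ht
  have hsb : s ∈ b.1 ⁻¹' {b.1 t} := h₁ ▸ (rfl : a.1 s = a.1 s)
  exact h₂.trans (Eq.symm hsb)

/-- The expectation domain of lotteries: plausibilities are events, utilities are consequences,
`X ⊗ c` is `{(X, c)}`, and `⊕` is union. -/
def lotteryDomain {S : Type u} {C : Type v} (le : Set (Set S × C) → Set (Set S × C) → Prop)
    (le_refl : ∀ x, le x x) :
    ExpectationDomain (ULift.{u} C) (ULift.{v} (Set S)) (Set (Set S × C)) where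
  leU c d := le {(Set.univ, c.down)} {(Set.univ, d.down)}
  leU_refl _ := le_refl _
  leP X Y := X.down ⊆ Y.down
  leP_refl _ := subset_rfl
  leP_trans _ _ _ := Set.Subset.trans
  leP_antisymm _ _ h₁ h₂ := ULift.down_injective (Set.Subset.antisymm h₁ h₂)
  bot := ⟨∅⟩
  top := ⟨Set.univ⟩
  bot_le _ := Set.empty_subset _
  le_top _ := Set.subset_univ _
  leV := le
  leV_refl := le_refl
  otimes X c := {(X.down, c.down)}
  oplus x y := x ∪ y
  oplus_assoc := Set.union_assoc
  oplus_comm := Set.union_comm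
  iota c := {(Set.univ, c.down)}
  iota_injective _ _ h := ULift.down_injective (Prod.mk.inj (Set.singleton_injective h)).2
  top_otimes _ := rfl
  leV_iota _ _ := Iff.rfl

theorem geuVal_lotteryDomain {S : Type u} {C : Type v} [Nonempty S]
    (le : Set (Set S × C) → Set (Set S × C) → Prop) (le_refl : ∀ x, le x x)
    (a : SimpleAct S C) :
    geuVal (lotteryDomain le le_refl) ULift.up ULift.up a = a.lottery := by
  refine (ExpectationDomain.geu_eq_iUnion _ (fun _ _ => rfl) _ _ _ _).trans ?_
  refine Set.iUnion_congr fun s => ?_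
  have h : (fun t => (ULift.up (a.1 t) : ULift.{u} C)) ⁻¹' {ULift.up (a.1 s)} =
      a.1 ⁻¹' {a.1 s} := by
    ext t
    simp
  rw [h]
  rfl

/-- Every reflexive preference relation on a nonempty set of simple acts has a GEU
representation: there are an expectation domain, a utility function, and a plausibility
measure whose generalized expected utility ordering coincides with the given relation. -/
theorem geu_represents_any_preference_relation {S : Type u} {C : Type v} [Nonempty S]
    (A : Set (SimpleAct S C)) (hA : A.Nonempty)
    (r : SimpleAct S C → SimpleAct S C → Prop)
    (hrefl : ∀ a ∈ A, r a a) :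
    ∃ (U : Type (max u v)) (P : Type (max u v)) (V : Type (max u v))
      (E : ExpectationDomain U P V) (u : C → U) (Pl : Set S → P),
      IsPlausMeasure E Pl ∧
      ∀ a₁ ∈ A, ∀ a₂ ∈ A, (r a₁ a₂ ↔ geuRel E Pl u a₁ a₂) := by
  let le : Set (Set S × C) → Set (Set S × C) → Prop := fun x y =>
    x = y ∨ ∃ a ∈ A, ∃ b ∈ A, r a b ∧ a.lottery = x ∧ b.lottery = y
  refine ⟨_, _, _, lotteryDomain le fun _ => Or.inl rfl, ULift.up, ULift.up,
    ⟨rfl, rfl, fun _ _ h => h⟩, fun a₁ h₁ a₂ h₂ => ?_⟩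
  rw [geuRel, geuVal_lotteryDomain, geuVal_lotteryDomain]
  constructor
  · exact fun h => Or.inr ⟨a₁, h₁, a₂, h₂, h, rfl, rfl⟩
  · rintro (h | ⟨a, -, b, -, h, ha, hb⟩)
    · exact SimpleAct.lottery_injective h ▸ hrefl a₁ h₁
    · rwa [← SimpleAct.lottery_injective ha, ← SimpleAct.lottery_injective hb]
end
end

section
/- Maximin has a GEU representation: let E_max = (ℝ, {0,1}, ℝ ∪ {∞}, ⊗, ⊕), where {0,1} is ordered by 0 < 1 (so ⊥ = 0, ⊤ = 1), ℝ ∪ {∞} carries the standard order, 1 ⊗ x = x and 0 ⊗ x = ∞ for x ∈ ℝ, and v ⊕ v' = min(v, v'); and let Pl_max : 2^S → {0,1} be given by Pl_max(∅) = 0 and Pl_max(X) = 1 for X ≠ ∅. Then E_max is an expectation domain, Pl_max is a plausibility measure, and for every nonempty set S, every u : C → ℝ, and every simple act a : S → C, E_{Pl_max,E_max}(u_a) = min_{s ∈ S} u_a(s). Consequently, for all simple acts a1, a2: a1 ⪯_{GEU} a2 under (E_max, u, Pl_max) iff min_{s∈S} u_{a1}(s) ≤ min_{s∈S} u_{a2}(s),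 which is exactly the Maximin ordering. -/
open Classical

noncomputable section

universe u v w x y z

/-- The expectation domain `E_max = (ℝ, {0,1}, ℝ ∪ {∞}, ⊗, min)`, where the plausibility
domain is `{0,1}` (modeled as `Bool` with `false < true`), `1 ⊗ x = x`, `0 ⊗ x = ∞`, and
`⊕ = min` on `ℝ ∪ {∞}` (modeled as `WithTop ℝ`). -/
noncomputable def EmaxED : ExpectationDomain ℝ Bool (WithTop ℝ) where
  leU := (· ≤ ·)
  leU_refl := le_refl
  leP := (· ≤ ·)
  leP_refl := le_refl
  leP_trans := fun _ _ _ => le_trans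
  leP_antisymm := fun _ _ => le_antisymm
  bot := false
  top := true
  bot_le := Bool.false_le
  le_top := Bool.le_true
  leV := (· ≤ ·)
  leV_refl := le_refl
  otimes := fun p y => if p then (y : WithTop ℝ) else ⊤
  oplus := min
  oplus_assoc := min_assoc
  oplus_comm := min_comm
  iota := fun y => (y : WithTop ℝ)
  iota_injective := fun a b h => by simpa using h
  top_otimes := fun a => by simp
  leV_iota := fun a b => WithTop.coe_le_coe

/-- The plausibility measure `Pl_max`: `Pl_max(∅) = 0` and `Pl_max(X) = 1` for `X ≠ ∅`. -/
noncomputable def PlMax (S : Type u) : Set S → Bool :=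
  fun X => if X = (∅ : Set S) then false else true

theorem isPlausMeasure_plMax (S : Type u) [Nonempty S] : IsPlausMeasure EmaxED (PlMax S) := by
  refine ⟨if_pos rfl, if_neg Set.univ_nonempty.ne_empty, fun X Y hXY => ?_⟩
  change PlMax S X ≤ PlMax S Y
  by_cases hX : X = ∅
  · simp [PlMax, hX]
  · have hY : Y ≠ ∅ := ((Set.nonempty_iff_ne_empty.mpr hX).mono hXY).ne_empty
    simp [PlMax, hX, hY]

theorem otimes_plMax_preimage {S : Type u} (f : S → ℝ) {z : ℝ} (hz : z ∈ Set.range f) :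
    EmaxED.otimes (PlMax S (f ⁻¹' {z})) z = (z : WithTop ℝ) := by
  obtain ⟨s, rfl⟩ := hz
  have h : f ⁻¹' {f s} ≠ ∅ := Set.Nonempty.ne_empty ⟨s, rfl⟩
  simp [PlMax, EmaxED, h]

/-- Folding `min` over a finite set from one of its points yields the infimum of the set. -/
theorem fold_min_erase_eq_sInf [DecidableEq ℝ] (t : Finset ℝ) (g : ℝ → WithTop ℝ)
    (hg : ∀ z ∈ t, g z = (z : WithTop ℝ)) {b : ℝ} (hb : b ∈ t) :
    (t.erase b).fold min (g b) g = ((sInf (t : Set ℝ) : ℝ) : WithTop ℝ) := by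
  have hmem : sInf (t : Set ℝ) ∈ t :=
    Finset.mem_coe.mp (Set.Nonempty.csInf_mem ⟨b, hb⟩ t.finite_toSet)
  have hle : ∀ z ∈ t, ((sInf (t : Set ℝ) : ℝ) : WithTop ℝ) ≤ g z := fun z hz => by
    rw [hg z hz]
    exact WithTop.coe_le_coe.mpr (csInf_le t.finite_toSet.bddBelow hz)
  apply le_antisymm
  · rw [Finset.fold_min_le]
    by_cases h : sInf (t : Set ℝ) = b
    · exact Or.inl (by rw [hg b hb, h])
    · exact Or.inr ⟨_, Finset.mem_erase.mpr ⟨h, hmem⟩, (hg _ hmem).le⟩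
  · rw [Finset.le_fold_min]
    exact ⟨hle b hb, fun z hz => hle z (Finset.mem_of_mem_erase hz)⟩

theorem geu_emaxED_plMax {S : Type u} (f : S → ℝ) (hf : (Set.range f).Finite)
    (hS : Nonempty S) :
    EmaxED.geu (PlMax S) f hf hS = ((sInf (Set.range f) : ℝ) : WithTop ℝ) := by
  have hne : hf.toFinset.Nonempty :=
    ⟨f (Classical.choice hS), hf.mem_toFinset.mpr (Set.mem_range_self _)⟩
  have h := @fold_min_erase_eq_sInf (Classical.decEq ℝ) hf.toFinset
    (fun z => EmaxED.otimes (PlMax S (f ⁻¹' {z})) z)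
    (fun z hz => otimes_plMax_preimage f (hf.mem_toFinset.mp hz)) _ hne.choose_spec
  rw [hf.coe_toFinset] at h
  exact h

/-- Maximin has a GEU representation: `Pl_max` is a plausibility measure, the generalized
expected utility of any simple act `a` in `(E_max, u, Pl_max)` equals the worst-case
utility `min_{s ∈ S} u_a(s)` (the infimum of the finite nonempty range of `u_a`), and
hence the GEU ordering of acts is exactly the Maximin ordering. -/
theorem maximin_geu_representation {S : Type u} {C : Type v} [Nonempty S] (u : C → ℝ) :
    IsPlausMeasure EmaxED (PlMax S) ∧
    (∀ a : SimpleAct S C,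
      geuVal EmaxED (PlMax S) u a =
        ((sInf (Set.range fun s => u (a.1 s)) : ℝ) : WithTop ℝ)) ∧
    (∀ a₁ a₂ : SimpleAct S C,
      geuRel EmaxED (PlMax S) u a₁ a₂ ↔
        sInf (Set.range fun s => u (a₁.1 s)) ≤ sInf (Set.range fun s => u (a₂.1 s))) := by
  refine ⟨isPlausMeasure_plMax S, fun a => geu_emaxED_plMax _ _ _, fun a₁ a₂ => ?_⟩
  change geuVal EmaxED (PlMax S) u a₁ ≤ geuVal EmaxED (PlMax S) u a₂ ↔ _
  rw [geuVal, geuVal, geu_emaxED_plMax, geu_emaxED_plMax]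
  exact WithTop.coe_le_coe
end
end

section
/- Minimax Regret has a GEU representation: let (A,S,C) be a decision situation with S nonempty and A a nonempty set of simple acts, let u : C → ℝ, define ū(s) = sup_{a∈A} u_a(s), assume M_D = sup_{s∈S} ū(s) < ∞, and for a ∈ A define the regret r̄(a) = sup_{s∈S} (ū(s) − u_a(s)). Let E_reg = (ℝ, [0,1], ℝ ∪ {∞}, ⊗, ⊕), where [0,1] has the standard order, x ⊗ y = y − log(x) if x > 0 and x ⊗ y = ∞ if x = 0, and v ⊕ v' = min(v, v'); and define Pl_D : 2^S → [0,1] by Pl_D(∅) = 0 and Pl_D(X) = e^{M_X − M_S} for X ≠ ∅, where M_X = sup_{s∈X} ū(s). Then E_reg is an expectation domain, Pl_D is a plausibility measure, and E_{Pl_D,E_reg}(u_a) = M_D − r̄(a) for every a ∈ A. Consequently a1 ⪯_{GEU} a2 under (E_reg, u, Pl_D) iff r̄(a1) ≥ r̄(a2), which is exactly the Minimax Regret ordering. -/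
open Classical

noncomputable section

universe u v w x y z

/-- The expectation domain `E_reg = (ℝ, [0,1], ℝ ∪ {∞}, ⊗, min)`, where
`x ⊗ y = y - log x` if `x > 0`, `x ⊗ y = ∞` if `x = 0`, and `⊕ = min`. -/
noncomputable def ERegED : ExpectationDomain ℝ (Set.Icc (0:ℝ) 1) (WithTop ℝ) where
  leU := (· ≤ ·)
  leU_refl := le_refl
  leP := (· ≤ ·)
  leP_refl := le_refl
  leP_trans := fun _ _ _ => le_trans
  leP_antisymm := fun _ _ => le_antisymm
  bot := ⟨0, by norm_num⟩
  top := ⟨1, by norm_num⟩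
  bot_le := fun p => p.2.1
  le_top := fun p => p.2.2
  leV := (· ≤ ·)
  leV_refl := le_refl
  otimes := fun p y => if (0:ℝ) < p.1 then ((y - Real.log p.1 : ℝ) : WithTop ℝ) else ⊤
  oplus := min
  oplus_assoc := min_assoc
  oplus_comm := min_comm
  iota := fun y => (y : WithTop ℝ)
  iota_injective := fun a b h => by simpa using h
  top_otimes := fun a => by norm_num [Real.log_one]
  leV_iota := fun a b => WithTop.coe_le_coe

/-- `ū(s) = sup_{a ∈ A} u_a(s)`, the least upper bound of the utilities in state `s`. -/
noncomputable def ubar {S : Type u} {C : Type v} (A : Set (SimpleAct S C)) (u : C → ℝ)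
    (s : S) : ℝ :=
  sSup ((fun a : SimpleAct S C => u (a.1 s)) '' A)

/-- `M_X = sup_{s ∈ X} ū(s)`. -/
noncomputable def MX {S : Type u} {C : Type v} (A : Set (SimpleAct S C)) (u : C → ℝ)
    (X : Set S) : ℝ :=
  sSup (ubar A u '' X)

/-- The regret `r̄(a) = sup_{s ∈ S} (ū(s) - u_a(s))` of an act `a`. -/
noncomputable def regret {S : Type u} {C : Type v} (A : Set (SimpleAct S C)) (u : C → ℝ)
    (a : SimpleAct S C) : ℝ :=
  sSup (Set.range fun s => ubar A u s - u (a.1 s))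

theorem ERegED.le_geu_iff {S : Type u} (Pl : Set S → Set.Icc (0:ℝ) 1) (f : S → ℝ)
    (hf : (Set.range f).Finite) (hS : Nonempty S) (c : WithTop ℝ) :
    c ≤ ERegED.geu Pl f hf hS ↔ ∀ s, c ≤ ERegED.otimes (Pl (f ⁻¹' {f s})) (f s) := by
  have hne : hf.toFinset.Nonempty :=
    ⟨f (Classical.choice hS), hf.mem_toFinset.mpr (Set.mem_range_self _)⟩
  have hmem : hne.choose ∈ Set.range f := hf.mem_toFinset.mp hne.choose_spec
  refine (Finset.le_fold_min c).trans ⟨fun h s => ?_, fun h => ⟨?_, fun z hz => ?_⟩⟩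
  · by_cases hs : f s = hne.choose
    · rw [hs]; exact h.1
    · exact h.2 _ (Finset.mem_erase.mpr ⟨hs, hf.mem_toFinset.mpr (Set.mem_range_self s)⟩)
  · obtain ⟨s, hs⟩ := hmem
    have := h s
    rw [hs] at this
    exact this
  · obtain ⟨s, rfl⟩ := hf.mem_toFinset.mp (Finset.mem_of_mem_erase hz)
    exact h s

theorem bddAbove_range_ubar {S : Type u} {C : Type v} {A : Set (SimpleAct S C)}
    (hA : A.Nonempty) {u : C → ℝ}
    (hbdd : BddAbove {y : ℝ | ∃ a ∈ A, ∃ s : S, y = u (a.1 s)}) :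
    BddAbove (Set.range (ubar A u)) := by
  obtain ⟨M, hM⟩ := hbdd
  refine ⟨M, ?_⟩
  rintro _ ⟨s, rfl⟩
  refine csSup_le (hA.image _) ?_
  rintro _ ⟨a, ha, rfl⟩
  exact hM ⟨a, ha, s, rfl⟩

theorem MX_le_iff {S : Type u} {C : Type v} {A : Set (SimpleAct S C)} {u : C → ℝ}
    (hb : BddAbove (Set.range (ubar A u))) {X : Set S} (hX : X.Nonempty) (c : ℝ) :
    MX A u X ≤ c ↔ ∀ s ∈ X, ubar A u s ≤ c :=
  (csSup_le_iff (hb.mono (Set.image_subset_range _ _)) (hX.image _)).trans Set.forall_mem_image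

theorem MX_mono {S : Type u} {C : Type v} {A : Set (SimpleAct S C)} {u : C → ℝ}
    (hb : BddAbove (Set.range (ubar A u))) {X Y : Set S} (hX : X.Nonempty) (hXY : X ⊆ Y) :
    MX A u X ≤ MX A u Y :=
  (MX_le_iff hb hX _).mpr fun s hs => (MX_le_iff hb (hX.mono hXY) _).mp le_rfl s (hXY hs)

theorem regret_le_iff {S : Type u} {C : Type v} [Nonempty S] {A : Set (SimpleAct S C)}
    {u : C → ℝ} (hb : BddAbove (Set.range (ubar A u))) (a : SimpleAct S C) (c : ℝ) :
    regret A u a ≤ c ↔ ∀ s, ubar A u s - u (a.1 s) ≤ c := by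
  refine (csSup_le_iff ?_ (Set.range_nonempty _)).trans Set.forall_mem_range
  obtain ⟨M, hM⟩ := hb
  obtain ⟨m, hm⟩ := (a.utility_range_finite u).bddBelow
  refine ⟨M - m, ?_⟩
  rintro _ ⟨s, rfl⟩
  exact sub_le_sub (hM (Set.mem_range_self s)) (hm (Set.mem_range_self s))

theorem geuVal_eq_sub_regret {S : Type u} {C : Type v} [Nonempty S] {A : Set (SimpleAct S C)}
    {u : C → ℝ} (hb : BddAbove (Set.range (ubar A u))) {Pl : Set S → Set.Icc (0:ℝ) 1}
    (hPl : ∀ X : Set S, X ≠ ∅ → (Pl X : ℝ) = Real.exp (MX A u X - MX A u Set.univ))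
    (a : SimpleAct S C) :
    geuVal ERegED Pl u a = ((MX A u Set.univ - regret A u a : ℝ) : WithTop ℝ) := by
  set f : S → ℝ := fun s => u (a.1 s)
  have hne (s : S) : (f ⁻¹' {f s}).Nonempty := ⟨s, rfl⟩
  have hterm (s : S) : ERegED.otimes (Pl (f ⁻¹' {f s})) (f s) =
      ((f s - (MX A u (f ⁻¹' {f s}) - MX A u Set.univ) : ℝ) : WithTop ℝ) := by
    have h := hPl _ (hne s).ne_empty
    simp only [ERegED, h, Real.exp_pos, if_true, Real.log_exp]
  refine eq_of_forall_le_iff fun c => (ERegED.le_geu_iff Pl f _ _ c).trans ?_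
  simp only [hterm]
  induction c with
  | top => simp
  | coe c =>
    simp only [WithTop.coe_le_coe]
    rw [le_sub_comm, regret_le_iff hb]
    constructor
    · intro h s
      have := (MX_le_iff hb (hne s) (f s + MX A u Set.univ - c)).mp (by linarith [h s]) s rfl
      change ubar A u s - f s ≤ _
      linarith
    · intro h s
      have : MX A u (f ⁻¹' {f s}) ≤ f s + MX A u Set.univ - c := by
        refine (MX_le_iff hb (hne s) _).mpr fun t (ht : f t = f s) => ?_
        have h' : ubar A u t - f t ≤ _ := h t
        linarith
      linarith

/-- Minimax Regret has a GEU representation: with the expectation domain `E_reg` and the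
plausibility measure `Pl_D` given by `Pl_D(∅) = 0` and `Pl_D(X) = e^{M_X - M_S}` for
`X ≠ ∅`, the generalized expected utility of every act `a ∈ A` equals `M_D - r̄(a)`, so
the GEU ordering is exactly the Minimax Regret ordering (higher expected utility
corresponds to lower regret). -/
theorem minimax_regret_geu_representation {S : Type u} {C : Type v} [Nonempty S]
    (A : Set (SimpleAct S C)) (hA : A.Nonempty) (u : C → ℝ)
    (hbdd : BddAbove {y : ℝ | ∃ a ∈ A, ∃ s : S, y = u (a.1 s)}) :
    ∃ Pl : Set S → (Set.Icc (0:ℝ) 1),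
      ((Pl ∅ : ℝ) = 0) ∧
      (∀ X : Set S, X ≠ ∅ → (Pl X : ℝ) = Real.exp (MX A u X - MX A u Set.univ)) ∧
      IsPlausMeasure ERegED Pl ∧
      (∀ a ∈ A, geuVal ERegED Pl u a =
        ((MX A u Set.univ - regret A u a : ℝ) : WithTop ℝ)) ∧
      (∀ a₁ ∈ A, ∀ a₂ ∈ A,
        (geuRel ERegED Pl u a₁ a₂ ↔ regret A u a₂ ≤ regret A u a₁)) := by
  have hb := bddAbove_range_ubar hA hbdd
  have hle (X : Set S) (hX : X ≠ ∅) : Real.exp (MX A u X - MX A u Set.univ) ≤ 1 :=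
    Real.exp_le_one_iff.mpr (sub_nonpos.mpr
      (MX_mono hb (Set.nonempty_iff_ne_empty.mpr hX) (Set.subset_univ X)))
  let Pl : Set S → Set.Icc (0:ℝ) 1 := fun X =>
    if hX : X = ∅ then ⟨0, by norm_num⟩
    else ⟨Real.exp (MX A u X - MX A u Set.univ), (Real.exp_pos _).le, hle X hX⟩
  have hempty : (Pl ∅ : ℝ) = 0 := by simp [Pl]
  have hPl (X : Set S) (hX : X ≠ ∅) :
      (Pl X : ℝ) = Real.exp (MX A u X - MX A u Set.univ) := by simp [Pl, hX]
  have hgeu := geuVal_eq_sub_regret hb hPl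
  refine ⟨Pl, hempty, hPl, ⟨Subtype.ext hempty, Subtype.ext ?_, fun X Y hXY => ?_⟩,
    fun a _ => hgeu a, fun a₁ _ a₂ _ => ?_⟩
  · rw [hPl _ Set.univ_nonempty.ne_empty, sub_self, Real.exp_zero]
    rfl
  · change (Pl X : ℝ) ≤ Pl Y
    rcases X.eq_empty_or_nonempty with rfl | hX
    · rw [hempty]
      exact (Pl Y).2.1
    · rw [hPl X hX.ne_empty, hPl Y (hX.mono hXY).ne_empty]
      exact Real.exp_le_exp.mpr (sub_le_sub_right (MX_mono hb hX hXY) _)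
  · change geuVal ERegED Pl u a₁ ≤ geuVal ERegED Pl u a₂ ↔ _
    rw [hgeu, hgeu, WithTop.coe_le_coe, sub_le_sub_iff_left]
end
end

section
/- Maxmin Expected Utility (MMEU) has a GEU representation: let S be a set, 𝒫 a nonempty set of finitely additive probability measures Pr : 2^S → [0,1], and Pl_𝒫 : 2^S → [0,1]^𝒫 defined by Pl_𝒫(X)(Pr) = Pr(X), where [0,1]^𝒫 is ordered pointwise. Let E_𝒫 = (ℝ, [0,1]^𝒫, ℝ^𝒫, ⊗, ⊕), where ℝ is identified with the constant functions in ℝ^𝒫, (p ⊗ y)(Pr) = y · p(Pr), ⊕ is pointwise addition, and f ≤_V g iff inf_{Pr∈𝒫} f(Pr) ≤ inf_{Pr∈𝒫} g(Pr). Then E_𝒫 is an expectation domain, Pl_𝒫 is a plausibility measure, and for every u : C → ℝ and every simple act a : S → C, E_{Pl_𝒫,E_𝒫}(u_a)(Pr) = Σ_{x ∈ ran(u_a)} Pr(u_a^{-1}(x)) · x for each Pr ∈ 𝒫. Consequently, for all simple acts a1, a2: a1 ⪯_{GEU} a2 under (E_𝒫, u, Pl_𝒫) iff inf_{Pr∈𝒫}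 Σ_x Pr(u_{a1}^{-1}(x))·x ≤ inf_{Pr∈𝒫} Σ_x Pr(u_{a2}^{-1}(x))·x, which is exactly the MMEU ordering. -/
open Classical

noncomputable section

universe u v w x y z

/-- A finitely additive probability measure on `S`: a `[0,1]`-valued set function with
`Pr ∅ = 0`, `Pr S = 1`, additive on disjoint sets. -/
def IsFinAddProb {S : Type u} (Pr : Set S → ℝ) : Prop :=
  Pr ∅ = 0 ∧ Pr Set.univ = 1 ∧ (∀ X : Set S, 0 ≤ Pr X ∧ Pr X ≤ 1) ∧
  ∀ X Y : Set S, Disjoint X Y → Pr (X ∪ Y) = Pr X + Pr Y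

/-- If `⊕` is pointwise addition, generalized expected utility is the pointwise sum of the terms
`Pl(f⁻¹(x)) ⊗ x` over the range of `f`. -/
theorem ExpectationDomain.geu_apply_of_oplus_eq_add {S : Type u} {U : Type w} {P : Type x}
    {I : Type y} (E : ExpectationDomain U P (I → ℝ))
    (hE : E.oplus = fun f g i => f i + g i) (Pl : Set S → P) (f : S → U)
    (hf : (Set.range f).Finite) (hS : Nonempty S) (i : I) :
    E.geu Pl f hf hS i = ∑ z ∈ hf.toFinset, E.otimes (Pl (f ⁻¹' {z})) z i := by
  let := Classical.decEq U
  let : Std.Commutative E.oplus := ⟨E.oplus_comm⟩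
  let : Std.Associative E.oplus := ⟨E.oplus_assoc⟩
  have fold_apply (s : Finset U) (b : I → ℝ) (g : U → I → ℝ) :
      s.fold E.oplus b g i = b i + ∑ z ∈ s, g z i := by
    induction s using Finset.induction_on with
    | empty => simp
    | insert a s ha ih =>
      rw [Finset.fold_insert ha, Finset.sum_insert ha, congrFun (congrFun hE _) _]
      simp only [ih]
      ring
  have hne : hf.toFinset.Nonempty :=
    ⟨f (Classical.choice hS), hf.mem_toFinset.mpr (Set.mem_range_self _)⟩
  refine (fold_apply (hf.toFinset.erase hne.choose) _ _).trans ?_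
  exact Finset.add_sum_erase _ (fun z => E.otimes (Pl (f ⁻¹' {z})) z i) hne.choose_spec

theorem IsFinAddProb.mono {S : Type u} {Pr : Set S → ℝ} (h : IsFinAddProb Pr) {X Y : Set S}
    (hXY : X ⊆ Y) : Pr X ≤ Pr Y := by
  obtain ⟨-, -, hb, hadd⟩ := h
  have hY := hadd X (Y \ X) Set.disjoint_sdiff_right
  rw [Set.union_sdiff_cancel hXY] at hY
  linarith [(hb (Y \ X)).1]

/-- The expectation domain `(ℝ, [0,1]^I, ℝ^I, ⊗, ⊕)` in which valuations are compared by their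
infima. -/
def maxminExpectationDomain (I : Type w) [Nonempty I] :
    ExpectationDomain ℝ (I → ↥(Set.Icc (0:ℝ) 1)) (I → ℝ) where
  leU a b := a ≤ b
  leU_refl := le_refl
  leP p q := p ≤ q
  leP_refl := le_refl
  leP_trans _ _ _ := le_trans
  leP_antisymm _ _ := le_antisymm
  bot := fun _ => 0
  top := fun _ => 1
  bot_le p i := (p i).2.1
  le_top p i := (p i).2.2
  leV f g := sInf (Set.range f) ≤ sInf (Set.range g)
  leV_refl _ := le_rfl
  otimes p a i := a * (p i : ℝ)
  oplus f g i := f i + g i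
  oplus_assoc a b c := funext fun _ => add_assoc _ _ _
  oplus_comm a b := funext fun _ => add_comm _ _
  iota a _ := a
  iota_injective _ _ h := congrFun h (Classical.arbitrary I)
  top_otimes a := funext fun _ => by simp
  leV_iota a b := by simp

/-- MMEU has a GEU representation: for a nonempty set `PP` of finitely additive probability
measures, there is an expectation domain `E_PP = (ℝ, [0,1]^PP, ℝ^PP, ⊗, ⊕)` (with `[0,1]^PP`
ordered pointwise, `(p ⊗ y)(Pr) = y · p(Pr)`, `⊕` pointwise addition, `ℝ` identified with
the constant functions, and `f ≤_V g` iff `inf_{Pr ∈ PP} f(Pr) ≤ inf_{Pr ∈ PP} g(Pr)`), and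
a plausibility measure `Pl_PP` with `Pl_PP(X)(Pr) = Pr(X)`, such that the generalized
expected utility of a simple act `a` evaluated at `Pr` is the standard expected utility
`Σ_{x ∈ ran(u_a)} Pr(u_a⁻¹(x)) · x`, and hence the GEU ordering is exactly the MMEU
ordering by worst-case expected utility. -/
theorem mmeu_geu_representation {S : Type u} {C : Type v}
    (PP : Set (Set S → ℝ)) (hPPne : PP.Nonempty) (hPP : ∀ Pr ∈ PP, IsFinAddProb Pr)
    [Nonempty S] (u : C → ℝ) :
    ∃ (E : ExpectationDomain ℝ (↥PP → ↥(Set.Icc (0:ℝ) 1)) (↥PP → ℝ))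
      (Pl : Set S → (↥PP → ↥(Set.Icc (0:ℝ) 1))),
      (∀ (X : Set S) (Pr : ↥PP), ((Pl X Pr : ℝ)) = Pr.1 X) ∧
      (E.leU = fun y₁ y₂ : ℝ => y₁ ≤ y₂) ∧
      (∀ p q : ↥PP → ↥(Set.Icc (0:ℝ) 1),
        E.leP p q ↔ ∀ Pr : ↥PP, (p Pr : ℝ) ≤ (q Pr : ℝ)) ∧
      (∀ f g : ↥PP → ℝ, E.leV f g ↔ sInf (Set.range f) ≤ sInf (Set.range g)) ∧
      (∀ f g : ↥PP → ℝ, E.oplus f g = fun Pr => f Pr + g Pr) ∧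
      (∀ (p : ↥PP → ↥(Set.Icc (0:ℝ) 1)) (y : ℝ) (Pr : ↥PP),
        E.otimes p y Pr = y * (p Pr : ℝ)) ∧
      (∀ y : ℝ, E.iota y = fun _ => y) ∧
      IsPlausMeasure E Pl ∧
      (∀ (a : SimpleAct S C) (Pr : ↥PP),
        geuVal E Pl u a Pr =
          ∑ x ∈ (SimpleAct.utility_range_finite u a).toFinset,
            Pr.1 ((fun s => u (a.1 s)) ⁻¹' {x}) * x) ∧
      (∀ a₁ a₂ : SimpleAct S C,
        geuRel E Pl u a₁ a₂ ↔
          sInf (Set.range fun Pr : ↥PP =>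
            ∑ x ∈ (SimpleAct.utility_range_finite u a₁).toFinset,
              Pr.1 ((fun s => u (a₁.1 s)) ⁻¹' {x}) * x) ≤
          sInf (Set.range fun Pr : ↥PP =>
            ∑ x ∈ (SimpleAct.utility_range_finite u a₂).toFinset,
              Pr.1 ((fun s => u (a₂.1 s)) ⁻¹' {x}) * x)) := by
  have : Nonempty ↥PP := hPPne.to_subtype
  let Pl : Set S → ↥PP → ↥(Set.Icc (0:ℝ) 1) := fun X Pr => ⟨Pr.1 X, (hPP Pr.1 Pr.2).2.2.1 X⟩
  have hgeu (a : SimpleAct S C) (Pr : ↥PP) :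
      geuVal (maxminExpectationDomain ↥PP) Pl u a Pr =
        ∑ x ∈ (SimpleAct.utility_range_finite u a).toFinset,
          Pr.1 ((fun s => u (a.1 s)) ⁻¹' {x}) * x :=
    (ExpectationDomain.geu_apply_of_oplus_eq_add _ rfl _ _ _ _ _).trans
      (Finset.sum_congr rfl fun _ _ => mul_comm _ _)
  refine ⟨maxminExpectationDomain ↥PP, Pl, fun _ _ => rfl, rfl, fun _ _ => Iff.rfl,
    fun _ _ => Iff.rfl, fun _ _ => rfl, fun _ _ _ => rfl, fun _ => rfl, ⟨?_, ?_, ?_⟩, hgeu, ?_⟩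
  · exact funext fun Pr => Subtype.ext (hPP Pr.1 Pr.2).1
  · exact funext fun Pr => Subtype.ext (hPP Pr.1 Pr.2).2.1
  · exact fun X Y hXY Pr => (hPP Pr.1 Pr.2).mono hXY
  · intro a₁ a₂
    rw [← funext (hgeu a₁), ← funext (hgeu a₂)]
    rfl
end
end

section
/- CEU is not uniform: let S = {s_1, s_2, s_3} and let Bel : 2^S → [0,1] be defined by Bel(X) = 1 if {s_1, s_2} ⊆ X and Bel(X) = 0 otherwise. Let f_1, f_2 : S → ℝ be given by f_1(s_j) = j and f_2(s_j) = 4 − j for j = 1,2,3. Then: (i) Bel is a monotone set function with Bel(∅) = 0 and Bel(S) = 1; (ii) Bel(f_i^{-1}({j})) = 0 for i ∈ {1,2} and j ∈ {1,2,3}, so f_1 and f_2 induce the same utility lottery with respect to Bel (both have range {1,2,3} and assign the same Bel-value to each preimage); and (iii) the Choquet expectations differ: E_Bel(f_1) = 1 while E_Bel(f_2) = 2. Hence the Choquet-expected-utility ordering distinguishes indistinguishable acts, i.e., CEU is not uniform. -/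
open Classical

noncomputable section

universe u

/-- The Choquet expectation `E_ν(f) = u_0 + Σ_{i=1}^n ν(X_i)(u_i − u_{i−1})` of a
function `f : S → ℝ` whose finite range is enumerated in increasing order by
`u : Fin (n+1) → ℝ`, where `X_i = f⁻¹({u_i, …, u_n})`. -/
noncomputable def choquet {S : Type u} (ν : Set S → ℝ) {n : ℕ} (u : Fin (n + 1) → ℝ)
    (f : S → ℝ) : ℝ :=
  u 0 + ∑ i : Fin n, ν (f ⁻¹' (u '' {j | i.succ ≤ j})) * (u i.succ - u i.castSucc)

/-- The belief function `Bel` on `S = {s_1, s_2, s_3}` with `Bel(X) = 1` iff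
`{s_1, s_2} ⊆ X` and `Bel(X) = 0` otherwise. -/
noncomputable def Bel3 : Set (Fin 3) → ℝ :=
  fun X => if ({0, 1} : Set (Fin 3)) ⊆ X then 1 else 0

/-- The act `a_1` with `a_1(s_j) = j`, as the utility random variable `f₁`. -/
noncomputable def f₁ : Fin 3 → ℝ := fun j => (j : ℕ) + 1

/-- The act `a_2` with `a_2(s_j) = 4 − j`, as the utility random variable `f₂`. -/
noncomputable def f₂ : Fin 3 → ℝ := fun j => 3 - (j : ℕ)

theorem Bel3_eq_one {X : Set (Fin 3)} (h0 : 0 ∈ X) (h1 : 1 ∈ X) : Bel3 X = 1 :=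
  if_pos (by rintro x (rfl | rfl) <;> assumption)

theorem Bel3_eq_zero_of_zero_notMem {X : Set (Fin 3)} (h : 0 ∉ X) : Bel3 X = 0 :=
  if_neg fun hX => h (hX (by simp))

theorem Bel3_eq_zero_of_one_notMem {X : Set (Fin 3)} (h : 1 ∉ X) : Bel3 X = 0 :=
  if_neg fun hX => h (hX (by simp))

theorem Bel3_mono {X Y : Set (Fin 3)} (h : X ⊆ Y) : Bel3 X ≤ Bel3 Y := by
  unfold Bel3
  split_ifs with hX hY
  · exact le_rfl
  · exact absurd (hX.trans h) hY
  · exact zero_le_one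
  · exact le_rfl

/-- A belief concentrated on `{s_1, s_2}` vanishes on preimages of points under any function
separating `s_1` and `s_2`. -/
theorem Bel3_preimage_singleton {f : Fin 3 → ℝ} (hf : f 0 ≠ f 1) (x : ℝ) :
    Bel3 (f ⁻¹' {x}) = 0 :=
  if_neg fun hX => hf ((hX (by simp : (0 : Fin 3) ∈ _)).trans
    (hX (by simp : (1 : Fin 3) ∈ _)).symm)

theorem range_f₁ : Set.range f₁ = {1, 2, 3} := by
  ext x
  simp only [Set.mem_range, Fin.exists_fin_succ, f₁]
  norm_num [eq_comm]

theorem range_f₂ : Set.range f₂ = {1, 2, 3} := by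
  ext x
  simp only [Set.mem_range, Fin.exists_fin_succ, f₂]
  norm_num [eq_comm]
  tauto

theorem choquet_f₁ : choquet Bel3 (n := 2) ![1, 2, 3] f₁ = 1 := by
  have h (i : Fin 2) : Bel3 (f₁ ⁻¹' (![1, 2, 3] '' {j | i.succ ≤ j})) = 0 := by
    apply Bel3_eq_zero_of_zero_notMem
    rintro ⟨j, hj, hj'⟩
    fin_cases i <;> fin_cases j <;> simp_all [f₁]
  simp [choquet, h]

theorem choquet_f₂ : choquet Bel3 (n := 2) ![1, 2, 3] f₂ = 2 := by
  have h0 : Bel3 (f₂ ⁻¹' (![1, 2, 3] '' {j | (0 : Fin 2).succ ≤ j})) = 1 := by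
    apply Bel3_eq_one
    · exact ⟨2, by decide, by simp [f₂]⟩
    · exact ⟨1, by decide, by norm_num [f₂]⟩
  have h1 : Bel3 (f₂ ⁻¹' (![1, 2, 3] '' {j | (1 : Fin 2).succ ≤ j})) = 0 := by
    apply Bel3_eq_zero_of_one_notMem
    rintro ⟨j, hj, hj'⟩
    fin_cases j <;> norm_num [f₂] at hj hj'
    exact absurd hj (by decide)
  rw [choquet, Fin.sum_univ_two, h0, h1]
  norm_num

/-- CEU is not uniform: (i) `Bel` is a monotone set function with `Bel(∅) = 0`,
`Bel(S) = 1`; (ii) `f₁` and `f₂` have the same range `{1,2,3}` and `Bel` assigns `0` to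
every singleton preimage, so they induce the same utility lottery (they are
indistinguishable); but (iii) their Choquet expectations are `1` and `2` respectively,
hence differ. -/
theorem ceu_not_uniform :
    (Bel3 ∅ = 0 ∧ Bel3 Set.univ = 1 ∧ ∀ X Y : Set (Fin 3), X ⊆ Y → Bel3 X ≤ Bel3 Y) ∧
    (Set.range f₁ = {1, 2, 3} ∧ Set.range f₂ = {1, 2, 3} ∧
      ∀ x ∈ ({1, 2, 3} : Set ℝ), Bel3 (f₁ ⁻¹' {x}) = 0 ∧ Bel3 (f₂ ⁻¹' {x}) = 0) ∧
    (choquet Bel3 (n := 2) ![1, 2, 3] f₁ = 1 ∧ choquet Bel3 (n := 2) ![1, 2, 3] f₂ = 2 ∧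
      choquet Bel3 (n := 2) ![1, 2, 3] f₁ ≠ choquet Bel3 (n := 2) ![1, 2, 3] f₂) := by
  refine ⟨⟨Bel3_eq_zero_of_zero_notMem (Set.notMem_empty 0),
    Bel3_eq_one (Set.mem_univ 0) (Set.mem_univ 1), fun _ _ => Bel3_mono⟩,
    ⟨range_f₁, range_f₂, fun x _ => ⟨Bel3_preimage_singleton ?_ x,
      Bel3_preimage_singleton ?_ x⟩⟩, choquet_f₁, choquet_f₂, ?_⟩
  · norm_num [f₁]
  · norm_num [f₂]
  · norm_num [choquet_f₁, choquet_f₂]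
end
end

section
/- The 'if' direction of the representation theorem, plausibilistic case: let D = ((A,S,C), E_1, u, Pl) be a plausibilistic decision problem whose expectation domain E_1 has utility domain (U, ≤_U) and plausibility domain (P, ≤_P), and let ⪯ be a reflexive binary relation on A such that (uniformity) whenever a_1 is indistinguishable from b_1 and a_2 is indistinguishable from b_2, a_1 ⪯ a_2 iff b_1 ⪯ b_2; and (respecting utility) whenever a_1, a_2 have constant utility x_1, x_2 (u_{a_i}(s) = x_i for all s ∈ S), a_1 ⪯ a_2 iff x_1 ≤_U x_2. Then there exists an expectation domain E_2 with the same utility domain (U, ≤_U) and the same plausibility domain (P, ≤_P) (but possibly new valuation domain V, relation ≤_V, and operations ⊗, ⊕) such that GEU(((A,S,C), E_2, u, Pl)) = ⪯. -/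
open Classical

noncomputable section

universe u v w x y z

/-- The utility lottery of an act, as the multiset of pairs `(Pl (u_a⁻¹ z), z)` with `z`
ranging over the utilities attained by the act. -/
def utilityLottery {S : Type u} {C : Type v} {U : Type w} {P : Type x}
    (Pl : Set S → P) (u : C → U) (a : SimpleAct S C) : Multiset (P × U) :=
  (SimpleAct.utility_range_finite u a).toFinset.val.map
    fun z => (Pl ((fun s => u (a.1 s)) ⁻¹' {z}), z)

theorem mem_utilityLottery {S : Type u} {C : Type v} {U : Type w} {P : Type x}
    {Pl : Set S → P} {u : C → U} {a : SimpleAct S C} {p : P} {z : U} :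
    (p, z) ∈ utilityLottery Pl u a ↔
      z ∈ Set.range (fun s => u (a.1 s)) ∧ Pl ((fun s => u (a.1 s)) ⁻¹' {z}) = p := by
  simp only [utilityLottery, Multiset.mem_map, Finset.mem_val, Set.Finite.mem_toFinset,
    Prod.mk.injEq]
  constructor
  · rintro ⟨t, ht, hp, rfl⟩
    exact ⟨ht, hp⟩
  · rintro ⟨hz, hp⟩
    exact ⟨z, hz, hp, rfl⟩

theorem indist_of_utilityLottery_eq {S : Type u} {C : Type v} {U : Type w} {P : Type x}
    {Pl : Set S → P} {u : C → U} {a b : SimpleAct S C}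
    (h : utilityLottery Pl u a = utilityLottery Pl u b) : Indist Pl u a b := by
  have key : ∀ {a b : SimpleAct S C}, utilityLottery Pl u a = utilityLottery Pl u b →
      ∀ z ∈ Set.range (fun s => u (a.1 s)), z ∈ Set.range (fun s => u (b.1 s)) ∧
        Pl ((fun s => u (b.1 s)) ⁻¹' {z}) = Pl ((fun s => u (a.1 s)) ⁻¹' {z}) :=
    fun h z hz => mem_utilityLottery.1 (h ▸ mem_utilityLottery.2 ⟨hz, rfl⟩)
  exact ⟨Set.Subset.antisymm (fun z hz => (key h z hz).1) (fun z hz => (key h.symm z hz).1),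
    fun z hz => (key h z hz).2.symm⟩

theorem utility_eq_of_utilityLottery_eq_singleton {S : Type u} {C : Type v} {U : Type w}
    {P : Type x} {Pl : Set S → P} {u : C → U} {a : SimpleAct S C} {p : P} {z : U}
    (h : utilityLottery Pl u a = {(p, z)}) (s : S) : u (a.1 s) = z := by
  have hs := mem_utilityLottery (Pl := Pl).2 ⟨Set.mem_range_self (f := fun s => u (a.1 s)) s, rfl⟩
  rw [h, Multiset.mem_singleton] at hs
  exact congrArg Prod.snd hs

/-- The expectation domain whose valuations are multisets of plausibility-utility pairs, with
`⊗` forming singletons and `⊕` adding multisets, ordered by a given relation. -/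
def ExpectationDomain.free {U : Type w} {P : Type x} {V : Type y} (E : ExpectationDomain U P V)
    (le : Multiset (P × U) → Multiset (P × U) → Prop) (le_refl : ∀ m, le m m)
    (le_singleton : ∀ a b, le {(E.top, a)} {(E.top, b)} ↔ E.leU a b) :
    ExpectationDomain U P (Multiset (P × U)) where
  leU := E.leU
  leU_refl := E.leU_refl
  leP := E.leP
  leP_refl := E.leP_refl
  leP_trans := E.leP_trans
  leP_antisymm := E.leP_antisymm
  bot := E.bot
  top := E.top
  bot_le := E.bot_le
  le_top := E.le_top
  leV := le
  leV_refl := le_refl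
  otimes p z := {(p, z)}
  oplus := (· + ·)
  oplus_assoc := add_assoc
  oplus_comm := add_comm
  iota z := {(E.top, z)}
  iota_injective _ _ h := congrArg Prod.snd (Multiset.singleton_inj.1 h)
  top_otimes _ := rfl
  leV_iota := le_singleton

theorem Finset.fold_add_singleton {α : Type*} {β : Type*}
    [Std.Commutative fun m n : Multiset β => m + n] [Std.Associative fun m n : Multiset β => m + n]
    (s : Finset α) (m : Multiset β) (g : α → β) :
    s.fold (· + ·) m (fun z => {g z}) = m + s.val.map g := by
  induction s using Finset.induction_on with
  | empty => simp
  | insert c s hc ih =>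
    rw [Finset.fold_insert hc, ih, Finset.insert_val_of_notMem hc, Multiset.map_cons,
      ← Multiset.singleton_add, add_left_comm]

theorem geuVal_free {S : Type u} {C : Type v} {U : Type w} {P : Type x} {V : Type y}
    [Nonempty S] (E : ExpectationDomain U P V)
    (le : Multiset (P × U) → Multiset (P × U) → Prop) (le_refl : ∀ m, le m m)
    (le_singleton : ∀ a b, le {(E.top, a)} {(E.top, b)} ↔ E.leU a b)
    (Pl : Set S → P) (u : C → U) (a : SimpleAct S C) :
    geuVal (E.free le le_refl le_singleton) Pl u a = utilityLottery Pl u a := by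
  have hne : (SimpleAct.utility_range_finite u a).toFinset.Nonempty := by
    simpa using Set.range_nonempty _
  refine (Finset.fold_add_singleton _ _
    fun z => (Pl ((fun s => u (a.1 s)) ⁻¹' {z}), z)).trans ?_
  change {_} + _ = _
  rw [Multiset.singleton_add, ← Multiset.map_cons (fun z => (Pl ((fun s => u (a.1 s)) ⁻¹' {z}), z)),
    Finset.erase_val, Multiset.cons_erase hne.choose_spec]
  rfl

/-- The 'if' direction of the representation theorem, plausibilistic case: if a reflexive
relation `r` on the acts of a plausibilistic decision problem is uniform (it respects
indistinguishability) and respects utility (it relates acts of constant utility as their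
utilities are related in `U`), then there is an expectation domain `E₂` with the *same*
utility domain `(U, leU)` and the *same* plausibility domain `(P, leP, ⊥, ⊤)` (only the
valuation domain `V`, its relation, and the operations `⊗`, `⊕` may change) whose GEU
ordering, with the same utility function and plausibility measure, is exactly `r`. -/
theorem geu_representation_if_plausibilistic {S : Type u} {C : Type v} {U : Type w}
    {P : Type x} {V₁ : Type y} [Nonempty S]
    (E₁ : ExpectationDomain U P V₁) (Pl : Set S → P) (hPl : IsPlausMeasure E₁ Pl)
    (u : C → U) (A : Set (SimpleAct S C))
    (r : SimpleAct S C → SimpleAct S C → Prop)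
    (hrefl : ∀ a ∈ A, r a a)
    (huniform : ∀ a₁ ∈ A, ∀ b₁ ∈ A, ∀ a₂ ∈ A, ∀ b₂ ∈ A,
      Indist Pl u a₁ b₁ → Indist Pl u a₂ b₂ → (r a₁ a₂ ↔ r b₁ b₂))
    (hrespect : ∀ a₁ ∈ A, ∀ a₂ ∈ A, ∀ x₁ x₂ : U,
      (∀ s, u (a₁.1 s) = x₁) → (∀ s, u (a₂.1 s) = x₂) →
      (r a₁ a₂ ↔ E₁.leU x₁ x₂)) :
    ∃ (V₂ : Type (max w x)) (E₂ : ExpectationDomain U P V₂),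
      E₂.leU = E₁.leU ∧ E₂.leP = E₁.leP ∧ E₂.bot = E₁.bot ∧ E₂.top = E₁.top ∧
      IsPlausMeasure E₂ Pl ∧
      ∀ a₁ ∈ A, ∀ a₂ ∈ A, (r a₁ a₂ ↔ geuRel E₂ Pl u a₁ a₂) := by
  let L := utilityLottery Pl u
  let le : Multiset (P × U) → Multiset (P × U) → Prop := fun m n =>
    m = n ∨ (∃ x y, m = {(E₁.top, x)} ∧ n = {(E₁.top, y)} ∧ E₁.leU x y) ∨
      ∃ a ∈ A, ∃ b ∈ A, m = L a ∧ n = L b ∧ r a b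
  have le_singleton : ∀ a b, le {(E₁.top, a)} {(E₁.top, b)} ↔ E₁.leU a b := by
    refine fun x y => ⟨?_, fun h => Or.inr (Or.inl ⟨x, y, rfl, rfl, h⟩)⟩
    rintro (h | ⟨x', y', hx, hy, h⟩ | ⟨a, ha, b, hb, hx, hy, h⟩)
    · obtain rfl : x = y := congrArg Prod.snd (Multiset.singleton_inj.1 h)
      exact E₁.leU_refl x
    · obtain rfl : x = x' := congrArg Prod.snd (Multiset.singleton_inj.1 hx)
      obtain rfl : y = y' := congrArg Prod.snd (Multiset.singleton_inj.1 hy)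
      exact h
    · exact (hrespect a ha b hb x y (utility_eq_of_utilityLottery_eq_singleton hx.symm)
        (utility_eq_of_utilityLottery_eq_singleton hy.symm)).1 h
  refine ⟨Multiset (P × U), E₁.free le (fun _ => Or.inl rfl) le_singleton,
    rfl, rfl, rfl, rfl, hPl, fun a ha b hb => ?_⟩
  rw [geuRel, geuVal_free, geuVal_free]
  refine ⟨fun h => Or.inr (Or.inr ⟨a, ha, b, hb, rfl, rfl, h⟩), ?_⟩
  rintro (h | ⟨x, y, hx, hy, h⟩ | ⟨a', ha', b', hb', hx, hy, h⟩)
  · exact (huniform a ha a ha a ha b hb (indist_of_utilityLottery_eq rfl)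
      (indist_of_utilityLottery_eq h)).1 (hrefl a ha)
  · exact (hrespect a ha b hb x y (utility_eq_of_utilityLottery_eq_singleton hx)
      (utility_eq_of_utilityLottery_eq_singleton hy)).2 h
  · exact (huniform a ha a' ha' b hb b' hb' (indist_of_utilityLottery_eq hx)
      (indist_of_utilityLottery_eq hy)).2 h
end
end

section
/- The 'if' direction of the representation theorem, nonplausibilistic case: let (A,S,C) be a decision situation with S nonempty and A a set of simple acts, let (U, ≤_U) be a set with a reflexive binary relation, let u : C → U, and let ⪯ be a reflexive binary relation on A such that (uniformity) whenever u_{a_1} = u_{b_1} and u_{a_2} = u_{b_2} as functions S → U, a_1 ⪯ a_2 iff b_1 ⪯ b_2; and (respecting utility) whenever a_1, a_2 have constant utility x_1, x_2 (u_{a_i}(s) = x_i for all s ∈ S), a_1 ⪯ a_2 iff x_1 ≤_U x_2. Then there exist an expectation domain E = (U, P, V, ⊗, ⊕) with utility domain (U, ≤_U) and a plausibility measure Pl : 2^S → P such that GEU(((A,S,C), E, u, Pl)) = ⪯. (In the paper's construction one takes P = (2^S, ⊆), Pl(X) = X, V = 2^{S×U}, X ⊗ x = X × {x}, and v ⊕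 v' = v ∪ v'.) -/
open Classical

noncomputable section

universe u v w x y z

/-- The graph of a utility random variable, as an element of `2^{S×U}`. -/
def utilityGraph {S : Type u} {U : Type w} (f : S → U) : Set (S × U) :=
  {p | f p.1 = p.2}

theorem utilityGraph_inj {S : Type u} {U : Type w} {f g : S → U} :
    utilityGraph f = utilityGraph g ↔ ∀ s, f s = g s := by
  refine ⟨fun h s => ?_, fun h => congrArg utilityGraph (funext h)⟩
  have hs : (s, f s) ∈ utilityGraph g := h ▸ (rfl : f s = f s)
  exact (hs : g s = f s).symm

/-- The relation on `2^{S×U}` that extends `leU` on constant graphs and `r` on graphs of acts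
in `A`. -/
def graphRel {S : Type u} {C : Type v} {U : Type w} (leU : U → U → Prop) (u : C → U)
    (A : Set (SimpleAct S C)) (r : SimpleAct S C → SimpleAct S C → Prop)
    (X Y : Set (S × U)) : Prop :=
  X = Y ∨
  (∃ a ∈ A, ∃ b ∈ A, X = utilityGraph (fun s => u (a.1 s)) ∧
    Y = utilityGraph (fun s => u (b.1 s)) ∧ r a b) ∨
  ∃ x y, X = utilityGraph (fun _ => x) ∧ Y = utilityGraph (fun _ => y) ∧ leU x y

theorem mem_fold_union {α : Type w} {β : Type y} (op : Set β → Set β → Set β)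
    [Std.Commutative op] [Std.Associative op] (hop : ∀ X Y, op X Y = X ∪ Y)
    (B : Set β) (g : α → Set β) (t : Finset α) (p : β) :
    p ∈ t.fold op B g ↔ p ∈ B ∨ ∃ z ∈ t, p ∈ g z := by
  induction t using Finset.induction_on with
  | empty => simp
  | insert a t ha ih =>
    rw [Finset.fold_insert ha, hop, Set.mem_union, ih, Finset.exists_mem_insert]
    tauto

/-- When `⊗` is `X ⊗ x = X × {x}` and `⊕` is union, the expected utility of `f` with respect to
the identity plausibility measure is the graph of `f`. -/
theorem geu_eq_utilityGraph {S : Type u} {U : Type w}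
    (E : ExpectationDomain U (Set S) (Set (S × U)))
    (hmul : ∀ X x, E.otimes X x = X ×ˢ {x}) (hadd : ∀ X Y, E.oplus X Y = X ∪ Y)
    (f : S → U) (hf : (Set.range f).Finite) (hS : Nonempty S) :
    E.geu id f hf hS = utilityGraph f := by
  ext ⟨s, x⟩
  have hmem : ∀ z, (s, x) ∈ E.otimes (id (f ⁻¹' {z})) z ↔ f s = z ∧ x = z := by
    intro z
    rw [hmul]
    rfl
  unfold ExpectationDomain.geu
  have : Std.Commutative E.oplus := ⟨E.oplus_comm⟩
  have : Std.Associative E.oplus := ⟨E.oplus_assoc⟩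
  refine (mem_fold_union E.oplus hadd _ _ _ _).trans ?_
  simp only [hmem]
  change _ ↔ f s = x
  constructor
  · rintro (⟨h, h'⟩ | ⟨z, -, h, h'⟩) <;> exact h.trans h'.symm
  · intro h
    refine or_iff_not_imp_left.mpr fun hne => ⟨x, Finset.mem_erase.mpr ⟨?_, ?_⟩, h, rfl⟩
    · intro hx
      exact hne ⟨h.trans hx, hx⟩
    · exact hf.mem_toFinset.mpr ⟨s, h⟩

/-- The 'if' direction of the representation theorem, nonplausibilistic case: if a
reflexive relation `r` on a set of simple acts is uniform (acts inducing the same utility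
random variable are interchangeable) and respects utility (acts of constant utility are
related as their utilities are), then there exist an expectation domain `E` whose utility
domain is the given `(U, leU)` and a plausibility measure `Pl` such that the GEU ordering
of `((A,S,C), E, u, Pl)` is exactly `r`.  (In the paper's construction `P = (2^S, ⊆)`,
`Pl(X) = X`, `V = 2^{S×U}`, `X ⊗ x = X × {x}`, and `⊕ = ∪`.) -/
theorem geu_representation_if_nonplausibilistic {S : Type u} {C : Type v} {U : Type w}
    [Nonempty S]
    (leU : U → U → Prop) (hleU : ∀ a, leU a a)
    (u : C → U) (A : Set (SimpleAct S C))
    (r : SimpleAct S C → SimpleAct S C → Prop)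
    (hrefl : ∀ a ∈ A, r a a)
    (huniform : ∀ a₁ ∈ A, ∀ b₁ ∈ A, ∀ a₂ ∈ A, ∀ b₂ ∈ A,
      (∀ s, u (a₁.1 s) = u (b₁.1 s)) → (∀ s, u (a₂.1 s) = u (b₂.1 s)) →
      (r a₁ a₂ ↔ r b₁ b₂))
    (hrespect : ∀ a₁ ∈ A, ∀ a₂ ∈ A, ∀ x₁ x₂ : U,
      (∀ s, u (a₁.1 s) = x₁) → (∀ s, u (a₂.1 s) = x₂) →
      (r a₁ a₂ ↔ leU x₁ x₂)) :
    ∃ (P : Type u) (V : Type (max u w)) (E : ExpectationDomain U P V)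
      (Pl : Set S → P),
      E.leU = leU ∧ IsPlausMeasure E Pl ∧
      ∀ a₁ ∈ A, ∀ a₂ ∈ A, (r a₁ a₂ ↔ geuRel E Pl u a₁ a₂) := by
  have hconst : ∀ x y : U,
      utilityGraph (fun _ : S => x) = utilityGraph (fun _ : S => y) ↔ x = y := fun x y =>
    utilityGraph_inj.trans (forall_const S)
  let E : ExpectationDomain U (Set S) (Set (S × U)) :=
    { leU := leU
      leU_refl := hleU
      leP := (· ⊆ ·)
      leP_refl := fun _ => subset_rfl
      leP_trans := fun _ _ _ => subset_trans
      leP_antisymm := fun _ _ => subset_antisymm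
      bot := ∅
      top := Set.univ
      bot_le := Set.empty_subset
      le_top := Set.subset_univ
      leV := graphRel leU u A r
      leV_refl := fun _ => Or.inl rfl
      otimes := fun X x => X ×ˢ {x}
      oplus := fun X Y => X ∪ Y
      oplus_assoc := Set.union_assoc
      oplus_comm := Set.union_comm
      iota := fun x => utilityGraph fun _ => x
      iota_injective := fun x y h => (hconst x y).1 h
      top_otimes := fun x => by
        ext ⟨s, y⟩
        simp [utilityGraph, eq_comm]
      leV_iota := fun x y => by
        constructor
        · rintro (h | ⟨a, ha, b, hb, hx, hy, h⟩ | ⟨x', y', hx, hy, h⟩)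
          · exact (hconst x y).1 h ▸ hleU x
          · exact (hrespect a ha b hb x y (utilityGraph_inj.1 hx.symm)
              (utilityGraph_inj.1 hy.symm)).1 h
          · rwa [(hconst x x').1 hx, (hconst y y').1 hy]
        · exact fun h => Or.inr (Or.inr ⟨x, y, rfl, rfl, h⟩) }
  have hval : ∀ a : SimpleAct S C, geuVal E id u a = utilityGraph fun s => u (a.1 s) := fun a =>
    geu_eq_utilityGraph E (fun _ _ => rfl) (fun _ _ => rfl) _ _ _
  refine ⟨Set S, Set (S × U), E, id, rfl, ⟨rfl, rfl, fun _ _ h => h⟩, fun a₁ h₁ a₂ h₂ => ?_⟩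
  rw [geuRel, hval, hval]
  constructor
  · exact fun h => Or.inr (Or.inl ⟨a₁, h₁, a₂, h₂, rfl, rfl, h⟩)
  · rintro (h | ⟨a, ha, b, hb, hx, hy, h⟩ | ⟨x, y, hx, hy, h⟩)
    · exact (huniform a₁ h₁ a₁ h₁ a₁ h₁ a₂ h₂ (fun _ => rfl) (utilityGraph_inj.1 h)).1
        (hrefl a₁ h₁)
    · exact (huniform a₁ h₁ a ha a₂ h₂ b hb (utilityGraph_inj.1 hx) (utilityGraph_inj.1 hy)).2 h
    · exact (hrespect a₁ h₁ a₂ h₂ x y (utilityGraph_inj.1 hx) (utilityGraph_inj.1 hy)).2 h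
end
end

section
/- Every lottery decision situation is induced by some plausibilistic decision situation: for every lottery decision situation (L, C, P) there exist a set S of states, a set A of simple acts a : S → C, and a plausibility measure Pl : 2^S → P such that ((A,S,C), P, Pl) induces (L, C, P), i.e., {ℓ^{Pl}_a : a ∈ A} = L. In fact one may take S = {f : L → C : f(ℓ) ∈ supp(ℓ) for all ℓ ∈ L}, A = {a_ℓ : ℓ ∈ L} where a_ℓ(f) = f(ℓ), and a plausibility measure Pl satisfying Pl(a_ℓ^{-1}(X)) = ℓ(X) for every ℓ ∈ L and every X ⊆ supp(ℓ). -/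
open Classical

noncomputable section

universe u v x

/-- A plausibility domain: a partially ordered set `(P, le)` with bottom and top
elements. -/
structure PlausDomain (P : Type x) where
  le : P → P → Prop
  le_refl : ∀ p, le p p
  le_trans : ∀ p q r, le p q → le q r → le p r
  le_antisymm : ∀ p q, le p q → le q p → p = q
  bot : P
  top : P
  bot_le : ∀ p, le bot p
  le_top : ∀ p, le p top

/-- `Pl : 2^S → P` is a plausibility measure: `Pl ∅ = ⊥`, `Pl S = ⊤`, and `Pl` is
monotone. -/
def IsPlausMeasureD {S : Type u} {P : Type x} (D : PlausDomain P) (Pl : Set S → P) :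
    Prop :=
  Pl ∅ = D.bot ∧ Pl Set.univ = D.top ∧ ∀ X Y : Set S, X ⊆ Y → D.le (Pl X) (Pl Y)

/-- A simple lottery over the consequences `C` with values in the plausibility domain
`D`: a plausibility measure `val` on the subsets of its finite nonempty support
(`val` is normalized by `val X = val (X ∩ supp)` so that it is determined by its values
on subsets of the support). -/
structure SimpleLottery (C : Type v) {P : Type x} (D : PlausDomain P) where
  supp : Set C
  supp_nonempty : supp.Nonempty
  supp_finite : supp.Finite
  val : Set C → P
  val_inter : ∀ X : Set C, val X = val (X ∩ supp)
  val_empty : val ∅ = D.bot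
  val_supp : val supp = D.top
  val_mono : ∀ X Y : Set C, X ⊆ Y → Y ⊆ supp → D.le (val X) (val Y)

/-- The lottery `ℓ^Pl_a` induced by a simple act `a` in a plausibilistic decision
situation: its support is `ran(a)` and `ℓ^Pl_a(Y) = Pl(a⁻¹(Y))` for `Y ⊆ ran(a)`. -/
def inducedLottery {S : Type u} {C : Type v} {P : Type x} (D : PlausDomain P)
    (Pl : Set S → P) (hPl : IsPlausMeasureD D Pl) (hS : Nonempty S)
    (a : SimpleAct S C) : SimpleLottery C D where
  supp := Set.range a.1
  supp_nonempty := by haveI := hS; exact Set.range_nonempty a.1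
  supp_finite := a.2
  val := fun Y => Pl (a.1 ⁻¹' (Y ∩ Set.range a.1))
  val_inter := fun X => by
    show Pl (a.1 ⁻¹' (X ∩ Set.range a.1)) =
      Pl (a.1 ⁻¹' (X ∩ Set.range a.1 ∩ Set.range a.1))
    rw [Set.inter_assoc, Set.inter_self]
  val_empty := by simpa using hPl.1
  val_supp := by
    show Pl (a.1 ⁻¹' (Set.range a.1 ∩ Set.range a.1)) = D.top
    rw [Set.inter_self]
    have h : a.1 ⁻¹' Set.range a.1 = Set.univ := by
      ext s; simp
    rw [h]; exact hPl.2.1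
  val_mono := fun X Y hXY _ =>
    hPl.2.2 _ _ (Set.preimage_mono (Set.inter_subset_inter_left _ hXY))

/-- The set of states used in the induction construction: functions choosing, for each
lottery in `L`, a consequence in its support. -/
def LStates {C : Type v} {P : Type x} {D : PlausDomain P}
    (L : Set (SimpleLottery C D)) : Type (max v x) :=
  {f : ↥L → C // ∀ ℓ : ↥L, f ℓ ∈ ℓ.1.supp}

namespace LStates

variable {C : Type v} {P : Type x} {D : PlausDomain P} {L : Set (SimpleLottery C D)}

theorem exists_apply_eq {ℓ : ↥L} {c : C} (hc : c ∈ ℓ.1.supp) : ∃ g : LStates L, g.1 ℓ = c := by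
  refine ⟨⟨fun m => if m = ℓ then c else m.1.supp_nonempty.some, fun m => ?_⟩, by simp⟩
  by_cases h : m = ℓ
  · subst h; simpa using hc
  · simpa [h] using m.1.supp_nonempty.some_mem

theorem exists_apply_eq_apply_eq {ℓ m : ↥L} (hne : m ≠ ℓ) {c d : C} (hc : c ∈ ℓ.1.supp)
    (hd : d ∈ m.1.supp) : ∃ g : LStates L, g.1 ℓ = c ∧ g.1 m = d := by
  obtain ⟨g, hg⟩ := exists_apply_eq hd
  refine ⟨⟨fun k => if k = ℓ then c else g.1 k, fun k => ?_⟩, by simp, by simp [hne, hg]⟩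
  by_cases h : k = ℓ
  · subst h; simpa using hc
  · simpa [h] using g.2 k

/-- The act `a_ℓ`, evaluating a state at the lottery `ℓ`. -/
def act (ℓ : ↥L) : SimpleAct (LStates L) C :=
  ⟨fun g => g.1 ℓ, ℓ.1.supp_finite.subset (Set.range_subset_iff.2 fun g => g.2 ℓ)⟩

theorem range_act (ℓ : ↥L) : Set.range (act ℓ).1 = ℓ.1.supp :=
  Set.Subset.antisymm (Set.range_subset_iff.2 fun g => g.2 ℓ) fun _ hc => exists_apply_eq hc

/-- The largest subset of the support of `ℓ` whose preimage under `a_ℓ` is contained in `E`. -/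
def core (ℓ : ↥L) (E : Set (LStates L)) : Set C :=
  {c | c ∈ ℓ.1.supp ∧ ∀ g : LStates L, g.1 ℓ = c → g ∈ E}

theorem core_subset (ℓ : ↥L) (E : Set (LStates L)) : core ℓ E ⊆ ℓ.1.supp := fun _ h => h.1

theorem core_mono (ℓ : ↥L) {E F : Set (LStates L)} (h : E ⊆ F) : core ℓ E ⊆ core ℓ F :=
  fun _ hc => ⟨hc.1, fun g hg => h (hc.2 g hg)⟩

theorem core_empty (ℓ : ↥L) : core ℓ ∅ = ∅ := by
  refine Set.eq_empty_of_forall_notMem fun c hc => ?_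
  obtain ⟨g, hg⟩ := exists_apply_eq hc.1
  exact hc.2 g hg

theorem core_univ (ℓ : ↥L) : core ℓ Set.univ = ℓ.1.supp := by
  ext c; simp [core]

theorem core_preimage_act (ℓ : ↥L) {X : Set C} (hX : X ⊆ ℓ.1.supp) :
    core ℓ ((act ℓ).1 ⁻¹' X) = X := by
  ext c
  constructor
  · rintro ⟨hc, h⟩
    obtain ⟨g, hg⟩ := exists_apply_eq hc
    have hgX : g.1 ℓ ∈ X := h g hg
    rwa [hg] at hgX
  · intro hc
    refine ⟨hX hc, fun g hg => ?_⟩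
    change g.1 ℓ ∈ X
    rwa [hg]

/-- No lottery other than `ℓ` has a nonempty core in `E`. -/
def OnlyCore (ℓ : ↥L) (E : Set (LStates L)) : Prop :=
  ∀ m : ↥L, (core m E).Nonempty → m = ℓ

/-- The value on `E` is determined by the only lottery with a nonempty core in `E`; it is `⊤`
when there are several such lotteries. -/
def plaus (E : Set (LStates L)) : P :=
  if h : ∃ ℓ : ↥L, OnlyCore ℓ E then h.choose.1.val (core h.choose E) else D.top

theorem plaus_of_onlyCore {ℓ : ↥L} {E : Set (LStates L)} (h : OnlyCore ℓ E) :
    plaus E = ℓ.1.val (core ℓ E) := by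
  have hex : ∃ ℓ : ↥L, OnlyCore ℓ E := ⟨ℓ, h⟩
  rw [plaus, dif_pos hex]
  by_cases heq : ℓ = hex.choose
  · rw [← heq]
  · have h1 : core ℓ E = ∅ :=
      Set.not_nonempty_iff_eq_empty.1 fun hn => heq (hex.choose_spec ℓ hn)
    have h2 : core hex.choose E = ∅ :=
      Set.not_nonempty_iff_eq_empty.1 fun hn => heq (h _ hn).symm
    rw [h1, h2, SimpleLottery.val_empty, SimpleLottery.val_empty]

theorem plaus_univ : plaus (Set.univ : Set (LStates L)) = D.top := by
  by_cases h : ∃ ℓ : ↥L, OnlyCore ℓ Set.univ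
  · obtain ⟨ℓ, hℓ⟩ := h
    rw [plaus_of_onlyCore hℓ, core_univ, SimpleLottery.val_supp]
  · rw [plaus, dif_neg h]

theorem isPlausMeasureD_plaus (hL : L.Nonempty) :
    IsPlausMeasureD D (plaus : Set (LStates L) → P) := by
  refine ⟨?_, plaus_univ, fun E F hEF => ?_⟩
  · obtain ⟨ℓ, hℓ⟩ := hL
    have h : OnlyCore (⟨ℓ, hℓ⟩ : ↥L) ∅ := fun m hm => by simp [core_empty] at hm
    rw [plaus_of_onlyCore h, core_empty, SimpleLottery.val_empty]
  · by_cases h : ∃ ℓ : ↥L, OnlyCore ℓ F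
    · obtain ⟨ℓ, hℓ⟩ := h
      have hE : OnlyCore ℓ E := fun m hm => hℓ m (hm.mono (core_mono m hEF))
      rw [plaus_of_onlyCore hℓ, plaus_of_onlyCore hE]
      exact ℓ.1.val_mono _ _ (core_mono ℓ hEF) (core_subset ℓ F)
    · rw [show plaus F = D.top from dif_neg h]
      exact D.le_top _

theorem plaus_preimage_act (ℓ : ↥L) {X : Set C} (hX : X ⊆ ℓ.1.supp) :
    plaus ((act ℓ).1 ⁻¹' X) = ℓ.1.val X := by
  by_cases h : ℓ.1.supp ⊆ X
  · have huniv : (act ℓ).1 ⁻¹' X = Set.univ := Set.eq_univ_of_forall fun g => h (g.2 ℓ)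
    rw [huniv, plaus_univ, hX.antisymm h, SimpleLottery.val_supp]
  · obtain ⟨c, hc, hcX⟩ := Set.not_subset.1 h
    have honly : OnlyCore ℓ ((act ℓ).1 ⁻¹' X) := by
      rintro m ⟨d, hd, hdX⟩
      by_contra hne
      obtain ⟨g, hgc, hgd⟩ := exists_apply_eq_apply_eq hne hc hd
      have hgX : g.1 ℓ ∈ X := hdX g hgd
      exact hcX (hgc ▸ hgX)
    rw [plaus_of_onlyCore honly, core_preimage_act ℓ hX]

theorem inducedLottery_act (hPl : IsPlausMeasureD D (plaus : Set (LStates L) → P))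
    (hS : Nonempty (LStates L)) (ℓ : ↥L) :
    inducedLottery D plaus hPl hS (act ℓ) = ℓ.1 := by
  have hsupp : (inducedLottery D plaus hPl hS (act ℓ)).supp = ℓ.1.supp := range_act ℓ
  have hval : (inducedLottery D plaus hPl hS (act ℓ)).val = ℓ.1.val := by
    funext Y
    change plaus ((act ℓ).1 ⁻¹' (Y ∩ Set.range (act ℓ).1)) = ℓ.1.val Y
    rw [range_act, plaus_preimage_act ℓ Set.inter_subset_right, ← ℓ.1.val_inter]
  generalize inducedLottery D plaus hPl hS (act ℓ) = k at hsupp hval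
  generalize ℓ.1 = l at hsupp hval
  cases k
  cases l
  cases hsupp
  cases hval
  rfl

end LStates

/-- Every lottery decision situation `(L, C, P)` is induced by some plausibilistic
decision situation: taking the states `S_L` to be the functions `f` with
`f(ℓ) ∈ supp(ℓ)` for all `ℓ ∈ L` and the acts `a_ℓ(f) = f(ℓ)`, there is a plausibility
measure `Pl` such that the set of lotteries induced by the acts is exactly `L`, and for
each `ℓ ∈ L` the act `a_ℓ` induces `ℓ` itself (so `Pl(a_ℓ⁻¹(X)) = ℓ(X)` for every
`X ⊆ supp(ℓ)`). -/
theorem lottery_situation_induced {C : Type v} {P : Type x} (D : PlausDomain P)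
    (L : Set (SimpleLottery C D)) (hL : L.Nonempty) :
    ∃ (hS : Nonempty (LStates L)) (A : Set (SimpleAct (LStates L) C))
      (Pl : Set (LStates L) → P) (hPl : IsPlausMeasureD D Pl),
      {m | ∃ a ∈ A, m = inducedLottery D Pl hPl hS a} = L ∧
      ∀ ℓ : ↥L, ∃ a ∈ A, (∀ g : LStates L, a.1 g = g.1 ℓ) ∧
        inducedLottery D Pl hPl hS a = ℓ.1 := by
  obtain ⟨ℓ₀, hℓ₀⟩ := hL
  obtain ⟨c, hc⟩ := ℓ₀.supp_nonempty
  obtain ⟨g₀, -⟩ := LStates.exists_apply_eq (ℓ := (⟨ℓ₀, hℓ₀⟩ : ↥L)) hc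
  have hPl := LStates.isPlausMeasureD_plaus (L := L) ⟨ℓ₀, hℓ₀⟩
  refine ⟨⟨g₀⟩, Set.range LStates.act, LStates.plaus, hPl, ?_, fun ℓ =>
    ⟨LStates.act ℓ, ⟨ℓ, rfl⟩, fun _ => rfl, LStates.inducedLottery_act hPl _ ℓ⟩⟩
  ext m
  constructor
  · rintro ⟨_, ⟨ℓ, rfl⟩, rfl⟩
    rw [LStates.inducedLottery_act]
    exact ℓ.2
  · intro hm
    exact ⟨_, ⟨⟨m, hm⟩, rfl⟩, (LStates.inducedLottery_act hPl _ ⟨m, hm⟩).symm⟩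
end
end
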